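/- Let E be a holomorphic vector bundle over ℂP¹ of rank r. Then E is holomorphically isomorphic to a direct sum ⊕_{i=1}^r O(d_i) of line bundles, and the multiset of integers {d_1, …, d_r} is uniquely determined by E. -/

import Mathlib

/-!  **Statement 4 (Birkhoff–Grothendieck).**
A holomorphic vector bundle of rank `r` over `ℂP¹` is described by a holomorphic
clutching function `g : ℂ \ {0} → GL(r, ℂ)` (the transition function between the two
standard charts of `ℂP¹`).  Two clutching functions describe holomorphically isomorphic
bundles iff they differ by composition with a matrix function `a` holomorphic on the
affine chart around `0` and a matrix function `b` holomorphic in the coordinate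
`w = z⁻¹` on the chart around `∞`, both pointwise invertible.  The direct sum
`⊕ O(d i)` corresponds to the diagonal clutching function `z ↦ diag(z ^ d i)`.
The theorem: every holomorphic bundle is isomorphic to such a sum, with the (sorted)
tuple of weights `d` uniquely determined. -/

/-- Holomorphic isomorphism of the bundles over `ℂP¹` determined by two clutching
functions. -/
def ClutchingEquiv (r : ℕ) (g g' : ℂ → Matrix (Fin r) (Fin r) ℂ) : Prop :=
  ∃ a b : ℂ → Matrix (Fin r) (Fin r) ℂ,
    (∀ i j, Differentiable ℂ (fun z => a z i j)) ∧ (∀ z, IsUnit (a z)) ∧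
    (∀ i j, Differentiable ℂ (fun w => b w i j)) ∧ (∀ w, IsUnit (b w)) ∧
    ∀ z : ℂ, z ≠ 0 → g' z = b z⁻¹ * g z * a z

section BirkhoffGrothendieck

open Complex Metric Set Filter Topology

section HolomorphicFunctions

variable {E : Type*} [NormedAddCommGroup E] [NormedSpace ℂ E]

/-- The substitution `ζ = ω⁻¹` in an integral over a circle centred at the origin. -/
theorem circleIntegral_comp_inv (f : ℂ → E) {ρ : ℝ} (hρ : 0 < ρ) :
    (∮ ζ in C(0, ρ⁻¹), f ζ) = ∮ ω in C(0, ρ), (ω ^ 2)⁻¹ • f ω⁻¹ := by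
  have h := intervalIntegral.integral_comp_sub_left (a := 0) (b := 2 * Real.pi)
    (fun θ : ℝ => deriv (circleMap 0 ρ⁻¹) θ • f (circleMap 0 ρ⁻¹ θ)) (2 * Real.pi)
  rw [sub_self, sub_zero] at h
  rw [circleIntegral, circleIntegral, ← h]
  refine intervalIntegral.integral_congr fun θ _ => ?_
  have hρ' : (ρ : ℂ) ≠ 0 := by exact_mod_cast hρ.ne'
  have h1 : circleMap 0 ρ⁻¹ (2 * Real.pi - θ) = (circleMap 0 ρ θ)⁻¹ := by
    simp only [circleMap, zero_add, mul_inv]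
    push_cast
    rw [sub_mul, Complex.exp_sub, Complex.exp_two_pi_mul_I, one_div]
  have h2 : circleMap 0 ρ θ ≠ 0 := by simp [circleMap, hρ']
  simp only [deriv_circleMap, h1, smul_smul]
  congr 1
  field_simp

theorem exists_differentiable_glue {U V : Set ℂ} (hU : IsOpen U) (hV : IsOpen V)
    (hUV : ∀ z, z ∈ U ∨ z ∈ V) {f g : ℂ → E} (hf : DifferentiableOn ℂ f U)
    (hg : DifferentiableOn ℂ g V) (hfg : ∀ z ∈ U, z ∈ V → f z = g z) :
    ∃ h : ℂ → E, Differentiable ℂ h ∧ EqOn h f U ∧ EqOn h g V := by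
  classical
  have h1 : EqOn (U.piecewise f g) f U := fun z hz => piecewise_eq_of_mem _ _ _ hz
  have h2 : EqOn (U.piecewise f g) g V := fun z hz => by
    by_cases hzU : z ∈ U
    · rw [h1 hzU, hfg z hzU hz]
    · exact piecewise_eq_of_notMem _ _ _ hzU
  refine ⟨U.piecewise f g, fun z => ?_, h1, h2⟩
  rcases hUV z with hz | hz
  · exact (hf.congr h1).differentiableAt (hU.mem_nhds hz)
  · exact (hg.congr h2).differentiableAt (hV.mem_nhds hz)

variable [CompleteSpace E]

theorem differentiableOn_cauchyIntegral {f : ℂ → E} {ρ : ℝ} (hρ : 0 < ρ)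
    (hf : ContinuousOn f (sphere 0 ρ)) :
    DifferentiableOn ℂ (fun z => (2 * Real.pi * I : ℂ)⁻¹ • ∮ ζ in C(0, ρ), (ζ - z)⁻¹ • f ζ)
      (ball 0 ρ) := by
  lift ρ to NNReal using hρ.le
  have := (hasFPowerSeriesOn_cauchy_integral (hf.circleIntegrable hρ.le)
    (by exact_mod_cast hρ)).differentiableOn
  rwa [eball_coe] at this

/-- Cauchy's integral formula in the annulus between two circles centred at the origin. -/
theorem cauchyIntegral_annulus {f : ℂ → E} {r R : ℝ} (hr : 0 < r)
    (hc : ContinuousOn f {z | r ≤ ‖z‖ ∧ ‖z‖ ≤ R})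
    (hd : DifferentiableOn ℂ f {z | r < ‖z‖ ∧ ‖z‖ < R}) {z : ℂ} (hz : r < ‖z‖) (hz' : ‖z‖ < R) :
    f z = (2 * Real.pi * I : ℂ)⁻¹ • (∮ ζ in C(0, R), (ζ - z)⁻¹ • f ζ) -
      (2 * Real.pi * I : ℂ)⁻¹ • ∮ ζ in C(0, r), (ζ - z)⁻¹ • f ζ := by
  have hrR : r ≤ R := (hz.trans hz').le
  have hopen : IsOpen {z : ℂ | r < ‖z‖ ∧ ‖z‖ < R} :=
    (isOpen_lt continuous_const continuous_norm).inter (isOpen_lt continuous_norm continuous_const)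
  have hset : closedBall (0 : ℂ) R \ ball 0 r = {z | r ≤ ‖z‖ ∧ ‖z‖ ≤ R} := by
    ext; simp [and_comm]
  have hmem : {z : ℂ | r ≤ ‖z‖ ∧ ‖z‖ ≤ R} ∈ 𝓝 z :=
    mem_of_superset (hopen.mem_nhds ⟨hz, hz'⟩) fun w hw => ⟨hw.1.le, hw.2.le⟩
  have hdz : DifferentiableAt ℂ f z := hd.differentiableAt (hopen.mem_nhds ⟨hz, hz'⟩)
  have hI := circleIntegral_eq_of_differentiable_on_annulus_off_countable (f := dslope f z)
    hr hrR (countable_singleton z)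
    (by rw [hset]; exact (continuousOn_dslope hmem).2 ⟨hc, hdz⟩)
    (fun w hw => by
      rw [differentiableAt_dslope_of_ne hw.2]
      refine hd.differentiableAt (hopen.mem_nhds ?_)
      have := hw.1
      simp only [Set.mem_sdiff, mem_ball_zero_iff, mem_closedBall_zero_iff, not_le] at this
      exact this.symm)
  have hexp : ∀ s : ℝ, 0 ≤ s → s ≠ ‖z‖ → sphere (0 : ℂ) s ⊆ {z | r ≤ ‖z‖ ∧ ‖z‖ ≤ R} →
      (∮ ζ in C(0, s), dslope f z ζ) =
        (∮ ζ in C(0, s), (ζ - z)⁻¹ • f ζ) - (∮ ζ in C(0, s), (ζ - z)⁻¹) • f z := by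
    intro s hs hsz hsub
    have hne : ∀ ζ ∈ sphere (0 : ℂ) s, ζ - z ≠ 0 := fun ζ hζ h => hsz <| by
      rw [← sub_eq_zero.1 h, mem_sphere_zero_iff_norm.1 hζ]
    have hinv : ContinuousOn (fun ζ => (ζ - z)⁻¹) (sphere 0 s) :=
      (continuousOn_id.sub continuousOn_const).inv₀ hne
    have hi₁ : CircleIntegrable (fun ζ => (ζ - z)⁻¹ • f ζ) 0 s :=
      (hinv.smul (hc.mono hsub)).circleIntegrable hs
    have hi₂ : CircleIntegrable (fun ζ => (ζ - z)⁻¹ • f z) 0 s :=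
      (hinv.smul continuousOn_const).circleIntegrable hs
    rw [← circleIntegral.integral_smul_const, ← circleIntegral.integral_sub hi₁ hi₂]
    refine circleIntegral.integral_congr hs fun ζ hζ => ?_
    rw [dslope_of_ne _ (sub_ne_zero.1 (hne ζ hζ)), slope_def_module, smul_sub]
  rw [hexp R (hr.le.trans hrR) hz'.ne' fun ζ hζ => by
      rw [mem_sphere_zero_iff_norm] at hζ; exact ⟨hζ ▸ hrR, hζ.le⟩,
    hexp r hr.le hz.ne fun ζ hζ => by
      rw [mem_sphere_zero_iff_norm] at hζ; exact ⟨hζ.ge, hζ ▸ hrR⟩,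
    circleIntegral.integral_sub_inv_of_mem_ball (by simpa using hz')] at hI
  have h0 : (∮ ζ in C(0, r), (ζ - z)⁻¹) = 0 := by
    refine DiffContOnCl.circleIntegral_eq_zero hr.le (DifferentiableOn.diffContOnCl ?_)
    rw [closure_ball _ hr.ne']
    refine (differentiableOn_id.sub_const z).inv fun ζ hζ h => ?_
    rw [mem_closedBall_zero_iff, show ζ = z from sub_eq_zero.1 h] at hζ
    exact absurd hζ hz.not_ge
  rw [h0, zero_smul, sub_zero] at hI
  rw [← smul_sub, eq_inv_smul_iff₀ Complex.two_pi_I_ne_zero, ← hI]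
  abel

/-- **Laurent splitting** of a holomorphic function on the annulus `ρ⁻¹ < ‖z‖ < ρ`, with bounds. -/
theorem exists_laurent_splitting {f : ℂ → E} {ρ M : ℝ} (hρ : 1 < ρ)
    (hc : ContinuousOn f {z | ρ⁻¹ ≤ ‖z‖ ∧ ‖z‖ ≤ ρ})
    (hd : DifferentiableOn ℂ f {z | ρ⁻¹ < ‖z‖ ∧ ‖z‖ < ρ})
    (hM : ∀ z, ρ⁻¹ ≤ ‖z‖ → ‖z‖ ≤ ρ → ‖f z‖ ≤ M) :
    ∃ p m : ℂ → E, DiffContOnCl ℂ p (ball 0 ρ) ∧ DifferentiableOn ℂ m (ball 0 ρ) ∧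
      (∀ z, ρ⁻¹ < ‖z‖ → ‖z‖ < ρ → f z = p z + m z⁻¹) ∧
      (∀ w, ‖w‖ < ρ → ‖m w‖ ≤ M * (‖w‖ / (ρ - ‖w‖))) ∧
      ∀ z, ‖z‖ ≤ ρ → ‖p z‖ ≤ M + M * (ρ⁻¹ / (ρ - ρ⁻¹)) := by
  have hρ0 : 0 < ρ := zero_lt_one.trans hρ
  have hρ1 : ρ⁻¹ < ρ := (inv_lt_one_of_one_lt₀ hρ).trans hρ
  set m : ℂ → E := fun w => w • ((2 * Real.pi * I : ℂ)⁻¹ •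
    ∮ ω in C(0, ρ), (ω - w)⁻¹ • (ω⁻¹ • f ω⁻¹)) with hm
  set P : ℂ → E := fun z => (2 * Real.pi * I : ℂ)⁻¹ • ∮ ζ in C(0, ρ), (ζ - z)⁻¹ • f ζ
  have hPd : DifferentiableOn ℂ P (ball 0 ρ) :=
    differentiableOn_cauchyIntegral hρ0 <| hc.mono fun z hz => by
      rw [mem_sphere_zero_iff_norm] at hz; exact ⟨hz ▸ hρ1.le, hz.le⟩
  have hmd : DifferentiableOn ℂ m (ball 0 ρ) := by
    refine differentiableOn_id.smul (differentiableOn_cauchyIntegral hρ0 ?_)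
    have hinv : ContinuousOn (fun ω : ℂ => ω⁻¹) (sphere 0 ρ) :=
      continuousOn_inv₀.mono fun z hz h => by simp_all
    refine hinv.smul (hc.comp hinv fun z hz => ?_)
    rw [mem_sphere_zero_iff_norm] at hz
    simp [hz, hρ1.le]
  have hmb : ∀ w, ‖w‖ < ρ → ‖m w‖ ≤ M * (‖w‖ / (ρ - ‖w‖)) := by
    intro w hw
    have hpos : 0 < ρ - ‖w‖ := sub_pos.2 hw
    have := circleIntegral.norm_two_pi_i_inv_smul_integral_le_of_norm_le_const (c := 0)
      (f := fun ω => (ω - w)⁻¹ • (ω⁻¹ • f ω⁻¹)) (C := (ρ - ‖w‖)⁻¹ * (ρ⁻¹ * M)) hρ0.le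
      fun ω hω => by
        rw [mem_sphere_zero_iff_norm] at hω
        rw [norm_smul, norm_smul, norm_inv, norm_inv, hω]
        gcongr
        · rw [← hω]; exact norm_sub_norm_le ω w
        · exact hM _ (by simp [hω]) (by simp [hω, hρ1.le])
    rw [hm, norm_smul]
    calc _ ≤ ‖w‖ * (ρ * ((ρ - ‖w‖)⁻¹ * (ρ⁻¹ * M))) := by gcongr
      _ = _ := by field_simp
  have hPm : ∀ z, ρ⁻¹ < ‖z‖ → ‖z‖ < ρ → f z = P z + m z⁻¹ := by
    intro z hz hz'
    have hz0 : z ≠ 0 := norm_pos_iff.1 ((inv_pos.2 hρ0).trans hz)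
    rw [cauchyIntegral_annulus (inv_pos.2 hρ0) hc hd hz hz', circleIntegral_comp_inv _ hρ0,
      sub_eq_add_neg]
    congr 1
    simp only [hm]
    rw [smul_comm, ← smul_neg]
    congr 1
    rw [← circleIntegral.integral_smul, ← neg_one_smul ℂ, ← circleIntegral.integral_smul]
    refine circleIntegral.integral_congr hρ0.le fun ω hω => ?_
    rw [mem_sphere_zero_iff_norm] at hω
    have hω0 : ω ≠ 0 := norm_pos_iff.1 (hω ▸ hρ0)
    have h1 : ω⁻¹ - z ≠ 0 := fun h => hz.ne <| by rw [← sub_eq_zero.1 h, norm_inv, hω]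
    have h2 : ω - z⁻¹ ≠ 0 := fun h => h1 <| by rw [sub_eq_zero.1 h, inv_inv, sub_self]
    simp only [smul_smul]
    congr 1
    have h3 : 1 - ω * z ≠ 0 := fun h => h1 <| by field_simp; rw [h, mul_zero]
    have h4 : ω * z - 1 ≠ 0 := fun h => h3 <| by linear_combination -h
    field_simp
    ring
  classical
  set p : ℂ → E := fun z => if ‖z‖ < ρ then P z else f z - m z⁻¹ with hp
  have hp1 : ∀ z, ‖z‖ < ρ → p z = P z := fun z hz => if_pos hz
  have hp2 : ∀ z, ρ⁻¹ < ‖z‖ → p z = f z - m z⁻¹ := fun z hz => by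
    by_cases h : ‖z‖ < ρ
    · rw [hp1 z h, hPm z hz h, add_sub_cancel_right]
    · exact if_neg h
  have hpd : DifferentiableOn ℂ p (ball 0 ρ) :=
    hPd.congr fun z hz => hp1 z (mem_ball_zero_iff.1 hz)
  have hpc : DiffContOnCl ℂ p (ball 0 ρ) := by
    refine ⟨hpd, ?_⟩
    rw [closure_ball _ hρ0.ne']
    intro z hz
    rw [mem_closedBall_zero_iff] at hz
    by_cases h : ‖z‖ < ρ
    · exact (hpd.differentiableAt (isOpen_ball.mem_nhds (mem_ball_zero_iff.2 h))
        ).continuousAt.continuousWithinAt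
    · have hzρ : ‖z‖ = ρ := le_antisymm hz (not_lt.1 h)
      have hz0 : z ≠ 0 := norm_pos_iff.1 (hzρ ▸ hρ0)
      have hnear : {w : ℂ | ρ⁻¹ < ‖w‖} ∈ 𝓝 z :=
        (isOpen_lt continuous_const continuous_norm).mem_nhds (by simpa [hzρ] using hρ1)
      have hfc : ContinuousWithinAt f (closedBall 0 ρ) z := by
        refine (hc z ⟨by rw [hzρ]; exact hρ1.le, hz⟩).mono_of_mem_nhdsWithin ?_
        filter_upwards [mem_nhdsWithin_of_mem_nhds hnear, self_mem_nhdsWithin] with w hw hw'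
        exact ⟨le_of_lt hw, mem_closedBall_zero_iff.1 hw'⟩
      have hmc : ContinuousAt (fun z => m z⁻¹) z :=
        ContinuousAt.comp (f := fun z : ℂ => z⁻¹) (hmd.differentiableAt (isOpen_ball.mem_nhds
          (by simpa [hzρ] using hρ1))).continuousAt (continuousAt_inv₀ hz0)
      refine (hfc.sub hmc.continuousWithinAt).congr_of_eventuallyEq ?_ (hp2 z (by rwa [hzρ]))
      filter_upwards [mem_nhdsWithin_of_mem_nhds hnear] with w hw using hp2 w hw
  refine ⟨p, m, hpc, hmd, fun z hz hz' => by rw [hp1 z hz']; exact hPm z hz hz', hmb, ?_⟩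
  intro z hz
  refine norm_le_of_forall_mem_frontier_norm_le isBounded_ball hpc (fun w hw => ?_)
    (by rwa [closure_ball _ hρ0.ne', mem_closedBall_zero_iff])
  rw [frontier_ball _ hρ0.ne', mem_sphere_zero_iff_norm] at hw
  have hw' : ρ⁻¹ < ‖w‖ := by rwa [hw]
  rw [hp2 w hw']
  have := hmb w⁻¹ (by rwa [norm_inv, hw])
  rw [norm_inv, hw] at this
  exact (norm_sub_le _ _).trans (add_le_add (hM w hw'.le hw.le) this)

end HolomorphicFunctions

section Existence

variable {E : Type*} [NormedAddCommGroup E] [NormedSpace ℂ E] [CompleteSpace E]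

/-- A holomorphic function on `ℂ \ {0}` is uniformly approximated on an annulus by functions
with at most a pole at the origin. -/
theorem exists_zpow_smul_approx {f : ℂ → E} (hf : DifferentiableOn ℂ f {z | z ≠ 0}) {δ : ℝ}
    (hδ : 0 < δ) :
    ∃ (n : ℕ) (q : ℂ → E), DifferentiableOn ℂ q (ball 0 4) ∧
      ∀ z, 2⁻¹ ≤ ‖z‖ → ‖z‖ ≤ 2 → ‖f z - (z ^ n)⁻¹ • q z‖ ≤ δ := by
  have hne : ∀ z : ℂ, (4 : ℝ)⁻¹ ≤ ‖z‖ → z ≠ 0 := fun z hz h => by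
    rw [h, norm_zero] at hz; norm_num at hz
  have hc : ContinuousOn f {z | (4 : ℝ)⁻¹ ≤ ‖z‖ ∧ ‖z‖ ≤ 4} :=
    hf.continuousOn.mono fun z hz => hne z hz.1
  have hcpt : IsCompact {z : ℂ | (4 : ℝ)⁻¹ ≤ ‖z‖ ∧ ‖z‖ ≤ 4} := by
    refine (isCompact_closedBall (0 : ℂ) 4).of_isClosed_subset
      ((isClosed_le continuous_const continuous_norm).inter
        (isClosed_le continuous_norm continuous_const)) fun z hz => ?_
    simpa using hz.2
  obtain ⟨M, hM⟩ := hcpt.exists_bound_of_continuousOn hc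
  obtain ⟨p, m, hp, hm, hpm, -, -⟩ := exists_laurent_splitting (by norm_num) hc
    (hf.mono fun z hz => hne z hz.1.le) (fun z h1 h2 => hM z ⟨h1, h2⟩)
  have hps := (hm.mono (closedBall_subset_ball (by norm_num : ((3 : NNReal) : ℝ) < 4))
    ).hasFPowerSeriesOnBall (by norm_num)
  set S := cauchyPowerSeries m 0 (3 : NNReal)
  obtain ⟨a, ha, C, -, hC⟩ := hps.uniform_geometric_approx (r' := 5 / 2)
    (by exact_mod_cast (by norm_num [← NNReal.coe_lt_coe] : (5 / 2 : NNReal) < 3))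
  have htend : Tendsto (fun n => C * a ^ n) atTop (𝓝 (C * 0)) :=
    (tendsto_pow_atTop_nhds_zero_of_lt_one ha.1.le ha.2).const_mul C
  rw [mul_zero] at htend
  obtain ⟨n, hn⟩ := (htend.eventually (gt_mem_nhds hδ)).exists
  refine ⟨n, fun z => z ^ n • p z + ∑ k ∈ Finset.range n, z ^ (n - k) • S k fun _ => 1, ?_, ?_⟩
  · exact ((differentiableOn_id.pow n).smul hp.differentiableOn).add <|
      DifferentiableOn.fun_sum fun k _ => (differentiableOn_id.pow _).smul_const _
  · intro z hz hz'
    have hz0 : z ≠ 0 := hne z ((by norm_num : (4 : ℝ)⁻¹ ≤ 2⁻¹).trans hz)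
    have hzi : ‖z⁻¹‖ ≤ 2 := by
      rw [norm_inv]; exact inv_le_of_inv_le₀ (by norm_num) hz
    have h := hC z⁻¹ (by
      rw [mem_ball_zero_iff]; refine hzi.trans_lt ?_; norm_num) n
    have hsum : (z ^ n)⁻¹ • (z ^ n • p z + ∑ k ∈ Finset.range n, z ^ (n - k) • S k fun _ => 1) =
        p z + S.partialSum n z⁻¹ := by
      rw [smul_add, inv_smul_smul₀ (pow_ne_zero n hz0), Finset.smul_sum,
        FormalMultilinearSeries.partialSum]
      congr 1
      refine Finset.sum_congr rfl fun k hk => ?_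
      have h1 : (S k fun _ => z⁻¹) = (z⁻¹) ^ k • S k fun _ => 1 := by
        simp
      rw [h1, smul_smul]
      congr 1
      rw [pow_sub₀ z hz0 (Finset.mem_range.1 hk).le, inv_mul_cancel_left₀ (pow_ne_zero n hz0),
        inv_pow]
    simp only [hsum]
    rw [hpm z ((by norm_num : (4 : ℝ)⁻¹ < 2⁻¹).trans_le hz) (hz'.trans_lt (by norm_num)),
      add_sub_add_left_eq_sub]
    rw [zero_add] at h
    exact h.trans hn.le

variable {A : Type*} [NormedRing A] [NormedAlgebra ℂ A] [CompleteSpace A]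

/-- **Birkhoff factorization near the identity**. -/
theorem exists_birkhoff_near_one (h_one : ‖(1 : A)‖ ≤ 1) {e : ℂ → A}
    (hc : ContinuousOn e {z | (2 : ℝ)⁻¹ ≤ ‖z‖ ∧ ‖z‖ ≤ 2})
    (hd : DifferentiableOn ℂ e {z | (2 : ℝ)⁻¹ < ‖z‖ ∧ ‖z‖ < 2})
    (hM : ∀ z, (2 : ℝ)⁻¹ ≤ ‖z‖ → ‖z‖ ≤ 2 → ‖e z‖ ≤ 1 / 4) :
    ∃ a k : ℂ → A, DifferentiableOn ℂ a (ball 0 2) ∧ DifferentiableOn ℂ k (ball 0 (3 / 2)) ∧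
      (∀ z, 2 / 3 < ‖z‖ → ‖z‖ < 2 → (1 + e z) * a z = k z⁻¹) ∧ IsUnit (a 1) := by
  let P : ℕ → (ℂ → A) → Prop := fun n a =>
    DiffContOnCl ℂ a (ball 0 2) ∧ ∀ z, ‖z‖ ≤ 2 → ‖a z‖ ≤ (1 / 3) ^ n
  have step : ∀ (n : ℕ) (a : {a // P n a}), ∃ (a' : {a // P (n + 1) a}) (m : ℂ → A),
      DifferentiableOn ℂ m (ball 0 (3 / 2)) ∧ (∀ w, ‖w‖ < 3 / 2 → ‖m w‖ ≤ (1 / 3) ^ n) ∧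
      ∀ z, 2 / 3 < ‖z‖ → ‖z‖ < 2 → e z * a.1 z = m z⁻¹ - a'.1 z := by
    rintro n ⟨a, had, hab⟩
    have hac : ContinuousOn a (closedBall 0 2) := by
      rw [← closure_ball _ two_ne_zero]; exact had.continuousOn
    obtain ⟨p, m, hp, hm, hpm, hmb, hpb⟩ := exists_laurent_splitting (ρ := 2)
      (f := fun z => e z * a z) (M := 1 / 4 * (1 / 3) ^ n) one_lt_two
      (hc.mul (hac.mono fun z hz => mem_closedBall_zero_iff.2 hz.2))
      (hd.mul (had.differentiableOn.mono fun z hz => mem_ball_zero_iff.2 hz.2))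
      (fun z hz hz' => (norm_mul_le _ _).trans
        (mul_le_mul (hM z hz hz') (hab z hz') (norm_nonneg _) (by norm_num)))
    refine ⟨⟨fun z => -p z, hp.neg, fun z hz => ?_⟩, m, hm.mono (ball_subset_ball (by norm_num)),
      fun w hw => ?_, fun z hz hz' => ?_⟩
    · rw [norm_neg]
      refine (hpb z hz).trans (le_of_eq ?_)
      rw [pow_succ]
      ring
    · refine (hmb w (hw.trans (by norm_num))).trans ?_
      have h1 : ‖w‖ / (2 - ‖w‖) ≤ 4 := by
        rw [div_le_iff₀ (by linarith)]; linarith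
      calc _ ≤ 1 / 4 * (1 / 3 : ℝ) ^ n * 4 := by gcongr
        _ = _ := by ring
    · rw [hpm z (lt_trans (by norm_num) hz) hz']
      simp [add_comm]
  choose next m hmd hmb hrel using step
  have h0 : P 0 fun _ => (1 : A) :=
    ⟨diffContOnCl_const, fun z _ => by simpa using h_one⟩
  let s : ∀ n, {a // P n a} := fun n => Nat.rec ⟨fun _ => 1, h0⟩ (fun n a => next n a) n
  have hsum : Summable fun n : ℕ => (1 / 3 : ℝ) ^ n :=
    summable_geometric_of_lt_one (by norm_num) (by norm_num)
  have hsa : ∀ z, ‖z‖ ≤ 2 → Summable fun n => (s n).1 z := fun z hz =>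
    Summable.of_norm_bounded hsum fun n => (s n).2.2 z hz
  have hsm : ∀ w, ‖w‖ < 3 / 2 → Summable fun n => m n (s n) w := fun w hw =>
    Summable.of_norm_bounded hsum fun n => hmb n (s n) w hw
  refine ⟨fun z => ∑' n, (s n).1 z, fun w => 1 + ∑' n, m n (s n) w, ?_, ?_, ?_, ?_⟩
  · exact differentiableOn_tsum_of_summable_norm hsum (fun n => (s n).2.1.differentiableOn)
      isOpen_ball fun n z hz => (s n).2.2 z (mem_ball_zero_iff.1 hz).le
  · exact (differentiableOn_tsum_of_summable_norm hsum (fun n => hmd n (s n))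
      isOpen_ball fun n z hz => hmb n (s n) z (mem_ball_zero_iff.1 hz)).const_add 1
  · intro z hz hz'
    have hz0 : 0 < ‖z‖ := lt_trans (by norm_num) hz
    have hw : ‖z⁻¹‖ < 3 / 2 := by
      rw [norm_inv]; exact inv_lt_of_inv_lt₀ (by norm_num) (by rwa [inv_div])
    have ha := hsa z hz'.le
    have e1 : e z * ∑' n, (s n).1 z = ∑' n, m n (s n) z⁻¹ - ∑' n, (s (n + 1)).1 z := by
      rw [← ha.tsum_mul_left, ← (hsm _ hw).tsum_sub ((summable_nat_add_iff 1).2 ha)]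
      exact tsum_congr fun n => hrel n (s n) z hz hz'
    have e2 : ∑' n, (s n).1 z = 1 + ∑' n, (s (n + 1)).1 z := ha.tsum_eq_zero_add
    simp only
    rw [add_mul, e1, one_mul, e2]
    abel
  · have h1 : ‖(1 : ℂ)‖ ≤ 2 := by simp
    have e2 : ∑' n, (s n).1 1 = 1 + ∑' n, (s (n + 1)).1 1 := (hsa 1 h1).tsum_eq_zero_add
    have hlt : ‖∑' n, (s (n + 1)).1 1‖ < 1 := by
      have hg : HasSum (fun n : ℕ => (1 / 3 : ℝ) ^ (n + 1)) (1 / 2) := by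
        have h2 := (hasSum_geometric_of_lt_one (by norm_num : (0 : ℝ) ≤ 1 / 3)
          (by norm_num)).mul_left (1 / 3)
        have h3 : (1 / 3 : ℝ) * (1 - 1 / 3)⁻¹ = 1 / 2 := by norm_num
        rw [h3] at h2
        exact h2.congr_fun fun n => (pow_succ' _ n)
      exact (tsum_of_norm_bounded hg fun n => (s (n + 1)).2.2 1 h1).trans_lt (by norm_num)
    simp only [e2]
    rw [← sub_neg_eq_add]
    exact (Units.oneSub _ (by rwa [norm_neg])).isUnit

/-- A clutching function `g` admits, after a twist, a frame which is holomorphic on both charts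
and does not degenerate at `1`. -/
theorem exists_global_sections (h_one : ‖(1 : A)‖ ≤ 1) {g : ℂ → A}
    (hg : DifferentiableOn ℂ g {z | z ≠ 0}) (hu : ∀ z, z ≠ 0 → IsUnit (g z)) :
    ∃ (n : ℕ) (a c : ℂ → A), Differentiable ℂ a ∧ Differentiable ℂ c ∧
      (∀ z, z ≠ 0 → g z * a z = z ^ n • c z⁻¹) ∧ IsUnit (a 1) := by
  have hopen : IsOpen {z : ℂ | z ≠ 0} := isOpen_ne
  have hinv : DifferentiableOn ℂ (fun z => Ring.inverse (g z)) {z | z ≠ 0} := fun z hz => by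
    obtain ⟨u, huz⟩ := hu z hz
    have h1 : DifferentiableAt ℂ (Ring.inverse : A → A) (g z) := by
      rw [← huz]; exact differentiableAt_inverse u.isUnit
    exact (h1.comp z (hg.differentiableAt (hopen.mem_nhds hz))).differentiableWithinAt
  have hne : ∀ z : ℂ, (2 : ℝ)⁻¹ ≤ ‖z‖ → z ≠ 0 := fun z hz h => by
    rw [h, norm_zero] at hz; norm_num at hz
  have hcpt : IsCompact {z : ℂ | (2 : ℝ)⁻¹ ≤ ‖z‖ ∧ ‖z‖ ≤ 2} := by
    refine (isCompact_closedBall (0 : ℂ) 2).of_isClosed_subset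
      ((isClosed_le continuous_const continuous_norm).inter
        (isClosed_le continuous_norm continuous_const)) fun z hz => ?_
    simpa using hz.2
  obtain ⟨K, hK⟩ := hcpt.exists_bound_of_continuousOn
    (hg.continuousOn.mono fun z hz => hne z hz.1)
  have hK0 : 0 ≤ K := (norm_nonneg _).trans (hK 1 (by norm_num))
  obtain ⟨n, q, hq, hqb⟩ := exists_zpow_smul_approx hinv
    (δ := 1 / (4 * (K + 1))) (by positivity)
  set e : ℂ → A := fun z => g z * ((z ^ n)⁻¹ • q z) - 1 with he
  have hed : DifferentiableOn ℂ e {z | z ≠ 0 ∧ ‖z‖ < 4} := by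
    have h1 : {z : ℂ | z ≠ 0 ∧ ‖z‖ < 4} ⊆ {z | z ≠ 0} := fun z hz => hz.1
    have h2 : {z : ℂ | z ≠ 0 ∧ ‖z‖ < 4} ⊆ ball 0 4 := fun z hz => mem_ball_zero_iff.2 hz.2
    have h3 : DifferentiableOn ℂ (fun z : ℂ => (z ^ n)⁻¹) {z | z ≠ 0 ∧ ‖z‖ < 4} :=
      (differentiableOn_id.pow n).inv fun z hz => pow_ne_zero n hz.1
    exact ((hg.mono h1).mul (h3.smul (hq.mono h2))).sub_const 1
  have heb : ∀ z, (2 : ℝ)⁻¹ ≤ ‖z‖ → ‖z‖ ≤ 2 → ‖e z‖ ≤ 1 / 4 := fun z hz hz' => by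
    have h1 : e z = -(g z * (Ring.inverse (g z) - (z ^ n)⁻¹ • q z)) := by
      rw [mul_sub, Ring.mul_inverse_cancel _ (hu z (hne z hz)), neg_sub]
    rw [h1, norm_neg]
    calc _ ≤ K * (1 / (4 * (K + 1))) := (norm_mul_le _ _).trans
          (mul_le_mul (hK z ⟨hz, hz'⟩) (hqb z hz hz') (norm_nonneg _) hK0)
      _ ≤ 1 / 4 := by
        rw [mul_one_div, div_le_div_iff₀ (by positivity) (by norm_num)]; linarith
  obtain ⟨a₀, k, ha₀, hk, hak, hunit⟩ := exists_birkhoff_near_one h_one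
    (hed.continuousOn.mono fun z hz => ⟨hne z hz.1, hz.2.trans_lt (by norm_num)⟩)
    (hed.mono fun z hz => ⟨hne z hz.1.le, hz.2.trans (by norm_num)⟩) heb
  have hk' : DifferentiableOn ℂ (fun z : ℂ => k z⁻¹) {z | 2 / 3 < ‖z‖} := by
    have hmaps : ∀ z : ℂ, 2 / 3 < ‖z‖ → z ≠ 0 ∧ ‖z⁻¹‖ < 3 / 2 := fun z hz => by
      have hz0 : 0 < ‖z‖ := lt_trans (by norm_num) hz
      refine ⟨norm_pos_iff.1 hz0, ?_⟩
      rw [norm_inv]; exact inv_lt_of_inv_lt₀ (by norm_num) (by rwa [inv_div])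
    exact hk.comp (differentiableOn_inv.mono fun z hz => (hmaps z hz).1)
      fun z hz => mem_ball_zero_iff.2 (hmaps z hz).2
  have hne' : ∀ z : ℂ, 2 / 3 < ‖z‖ → z ≠ 0 := fun z hz =>
    norm_pos_iff.1 (lt_trans (by norm_num) hz)
  have hrel : ∀ z : ℂ, 2 / 3 < ‖z‖ → ‖z‖ < 2 → g z * (q z * a₀ z) = z ^ n • k z⁻¹ := by
    intro z hz hz'
    rw [← hak z hz hz', he]
    simp only [add_sub_cancel, mul_smul_comm, smul_mul_assoc]
    rw [smul_inv_smul₀ (pow_ne_zero n (hne' z hz)), mul_assoc]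
  obtain ⟨a, had, ha1, ha2⟩ := exists_differentiable_glue (U := ball 0 2)
    (V := {z : ℂ | 2 / 3 < ‖z‖}) isOpen_ball (isOpen_lt continuous_const continuous_norm)
    (fun z => by
      rw [mem_ball_zero_iff, mem_ofPred_eq, or_iff_not_imp_left, not_lt]
      exact fun h => lt_of_lt_of_le (by norm_num) h)
    (f := fun z => q z * a₀ z)
    (g := fun z => Ring.inverse (g z) * (z ^ n • k z⁻¹))
    ((hq.mono (ball_subset_ball (by norm_num))).mul ha₀)
    ((hinv.mono fun z hz => hne' z hz).mul ((differentiableOn_id.pow n).smul hk'))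
    (fun z hz hz' => by
      rw [← hrel z hz' (mem_ball_zero_iff.1 hz), ← mul_assoc,
        Ring.inverse_mul_cancel _ (hu z (hne' z hz')), one_mul])
  have hrel2 : ∀ z : ℂ, 2 / 3 < ‖z‖ → g z * a z = z ^ n • k z⁻¹ := fun z hz => by
    rw [ha2 hz, ← mul_assoc, Ring.mul_inverse_cancel _ (hu z (hne' z hz)), one_mul]
  obtain ⟨c, hcd, hc1, -⟩ := exists_differentiable_glue (U := {w : ℂ | w ≠ 0})
    (V := ball 0 (3 / 2)) hopen isOpen_ball
    (fun w => by
      rw [or_iff_not_imp_left]; intro h; rw [mem_ofPred_eq, not_not] at h; simp [h])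
    (f := fun w => w ^ n • (g w⁻¹ * a w⁻¹)) (g := k)
    ((differentiableOn_id.pow n).smul ((hg.comp differentiableOn_inv
      fun w hw => inv_ne_zero hw).mul (had.comp_differentiableOn differentiableOn_inv)))
    hk (fun w hw hw' => by
      have h1 : 2 / 3 < ‖w⁻¹‖ := by
        rw [norm_inv, ← inv_div]
        exact inv_strictAnti₀ (norm_pos_iff.2 hw) (mem_ball_zero_iff.1 hw')
      rw [hrel2 _ h1, inv_inv, smul_smul, ← mul_pow, mul_inv_cancel₀ hw, one_pow, one_smul])
  refine ⟨n, a, c, had, hcd, fun z hz => ?_, ?_⟩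
  · simp only [hc1 (inv_ne_zero hz)]
    rw [inv_inv, smul_smul, ← mul_pow, mul_inv_cancel₀ hz, one_pow, one_smul]
  · have h1 : (2 / 3 : ℝ) < ‖(1 : ℂ)‖ := by norm_num
    have h2 : IsUnit (1 + e 1) := by
      rw [← sub_neg_eq_add]
      refine (Units.oneSub (-e 1) ?_).isUnit
      rw [norm_neg]
      exact (heb 1 (by norm_num) (by norm_num)).trans_lt (by norm_num)
    have h3 : g 1 * a 1 = (1 + e 1) * a₀ 1 := by
      rw [hrel2 1 h1, hak 1 h1 (by norm_num), one_pow, one_smul]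
    obtain ⟨u, hu1⟩ := hu 1 one_ne_zero
    rw [← Units.isUnit_units_mul u, hu1, h3]
    exact h2.mul hunit

end Existence

section Matrices

open Matrix

attribute [local instance] Matrix.linftyOpNormedRing Matrix.linftyOpNormedAlgebra

variable {n : Type*} [Fintype n] [DecidableEq n]

theorem differentiableOn_matrix_iff {f : ℂ → Matrix n n ℂ} {s : Set ℂ} :
    DifferentiableOn ℂ f s ↔ ∀ i j, DifferentiableOn ℂ (fun z => f z i j) s := by
  refine ⟨fun h i j => ?_, fun h => ?_⟩
  · exact (LinearMap.toContinuousLinearMap (Matrix.entryLinearMap ℂ ℂ i j)).differentiable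
      |>.comp_differentiableOn h
  · have h1 : f = fun z => ∑ i, ∑ j, f z i j • Matrix.single i j (1 : ℂ) := by
      funext z
      conv_lhs => rw [matrix_eq_sum_single (f z)]
      simp [smul_single]
    rw [h1]
    exact DifferentiableOn.fun_sum fun i _ => DifferentiableOn.fun_sum fun j _ =>
      (h i j).smul_const _

theorem differentiable_matrix_iff {f : ℂ → Matrix n n ℂ} :
    Differentiable ℂ f ↔ ∀ i j, Differentiable ℂ (fun z => f z i j) := by
  simp only [← differentiableOn_univ, differentiableOn_matrix_iff]

theorem DifferentiableOn.matrix_mulVec {f : ℂ → Matrix n n ℂ} {v : ℂ → n → ℂ} {s : Set ℂ}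
    (hf : DifferentiableOn ℂ f s) (hv : DifferentiableOn ℂ v s) :
    DifferentiableOn ℂ (fun z => f z *ᵥ v z) s := by
  rw [differentiableOn_matrix_iff] at hf
  rw [differentiableOn_pi] at hv ⊢
  exact fun i => DifferentiableOn.fun_sum fun j _ => (hf i j).mul (hv j)

theorem DifferentiableOn.matrix_det {f : ℂ → Matrix n n ℂ} {s : Set ℂ}
    (hf : DifferentiableOn ℂ f s) : DifferentiableOn ℂ (fun z => (f z).det) s := by
  rw [differentiableOn_matrix_iff] at hf
  simp only [det_apply]
  exact DifferentiableOn.fun_sum fun σ _ => (DifferentiableOn.fun_finsetProd fun i _ =>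
    hf (σ i) i).const_smul _

theorem DifferentiableOn.matrix_inv {f : ℂ → Matrix n n ℂ} {s : Set ℂ} (hs : IsOpen s)
    (hf : DifferentiableOn ℂ f s) (hu : ∀ z ∈ s, IsUnit (f z)) :
    DifferentiableOn ℂ (fun z => (f z)⁻¹) s := by
  have : CompleteSpace (Matrix n n ℂ) := FiniteDimensional.complete ℂ _
  intro z hz
  have h1 : DifferentiableAt ℂ (Ring.inverse : Matrix n n ℂ → Matrix n n ℂ) (f z) :=
    differentiableAt_inverse (hu z hz)
  simp only [nonsing_inv_eq_ringInverse]
  exact (h1.comp z (hf.differentiableAt (hs.mem_nhds hz))).differentiableWithinAt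

theorem Differentiable.matrix_updateCol {f : ℂ → Matrix n n ℂ} {v : ℂ → n → ℂ}
    (hf : Differentiable ℂ f) (hv : Differentiable ℂ v) (j : n) :
    Differentiable ℂ fun z => (f z).updateCol j (v z) := by
  rw [differentiable_matrix_iff] at hf ⊢
  intro i k
  by_cases hk : k = j
  · subst hk; simpa using differentiable_pi.1 hv i
  · simpa [hk] using hf i k

/-- An entire function which is `O(z⁻¹)` at infinity, in the strong sense that it is a negative
power of `z` times a holomorphic function of `z⁻¹`, vanishes. -/
theorem eq_zero_of_eq_zpow_mul_inv {F G : ℂ → ℂ} (hF : Differentiable ℂ F) (hG : ContinuousAt G 0)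
    {k : ℤ} (hk : k < 0) (h : ∀ z, z ≠ 0 → F z = z ^ k * G z⁻¹) (z : ℂ) : F z = 0 := by
  refine hF.apply_eq_of_tendsto_cocompact z ?_
  have hinv : Tendsto (fun z : ℂ => z⁻¹) (cocompact ℂ) (𝓝 0) := by
    rw [← Metric.cobounded_eq_cocompact]; exact tendsto_inv₀_cobounded
  obtain ⟨m, hm⟩ : ∃ m : ℕ, k = -((m + 1 : ℕ) : ℤ) :=
    ⟨(-k - 1).toNat, by push_cast; rw [Int.toNat_of_nonneg (by lia)]; ring⟩
  have hlim := (hinv.pow (m + 1)).mul (hG.tendsto.comp hinv)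
  rw [zero_pow m.succ_ne_zero, zero_mul] at hlim
  refine hlim.congr' ?_
  have hne : ∀ᶠ z : ℂ in cocompact ℂ, z ≠ 0 :=
    (isCompact_singleton (x := (0 : ℂ))).compl_mem_cocompact
  filter_upwards [hne] with z hz
  rw [h z hz, hm, _root_.zpow_neg, zpow_natCast, inv_pow]
  rfl

theorem prod_zpow_eq_zpow_sum (d : n → ℤ) {z : ℂ} (hz : z ≠ 0) :
    ∏ i, z ^ d i = z ^ ∑ i, d i := by
  induction (Finset.univ : Finset n) using Finset.induction_on with
  | empty => simp
  | insert i s hi ih => rw [Finset.prod_insert hi, Finset.sum_insert hi, ih, zpow_add₀ hz]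

/-- `a` and `c` are the local expressions of a morphism `⊕ O(-d i) ⟶ E`, where `E` is the bundle
with clutching function `g`, which is an isomorphism at the point `1`. -/
structure IsFrame (g : ℂ → Matrix n n ℂ) (d : n → ℤ) (a c : ℂ → Matrix n n ℂ) : Prop where
  differentiable_left : Differentiable ℂ a
  differentiable_right : Differentiable ℂ c
  mul_eq : ∀ z, z ≠ 0 → g z * a z = c z⁻¹ * diagonal fun i => z ^ d i
  det_ne_zero : (a 1).det ≠ 0

namespace IsFrame

variable {g a c : ℂ → Matrix n n ℂ} {d : n → ℤ}

/-- Exchanging the two charts. -/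
theorem swap (h : IsFrame g d a c) (hu : ∀ z, z ≠ 0 → IsUnit (g z)) :
    IsFrame (fun w => (g w⁻¹)⁻¹) d c a := by
  have hdet : ∀ z, z ≠ 0 → IsUnit (g z).det := fun z hz => (isUnit_iff_isUnit_det _).1 (hu z hz)
  refine ⟨h.differentiable_right, h.differentiable_left, fun w hw => ?_, fun h0 => ?_⟩
  · have h1 := h.mul_eq w⁻¹ (inv_ne_zero hw)
    have h2 : c w = g w⁻¹ * a w⁻¹ * diagonal fun i => w ^ d i := by
      rw [h1, inv_inv, Matrix.mul_assoc, diagonal_mul_diagonal]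
      simp [inv_mul_cancel₀ (zpow_ne_zero _ hw)]
    rw [h2, Matrix.mul_assoc, nonsing_inv_mul_cancel_left _ _ (hdet _ (inv_ne_zero hw))]
  · have h1 := congrArg det (h.mul_eq 1 one_ne_zero)
    rw [det_mul, det_mul, inv_one, h0, zero_mul] at h1
    exact mul_ne_zero (hdet 1 one_ne_zero).ne_zero h.det_ne_zero h1

/-- Elementary transformation at a point of the first chart where the frame degenerates. -/
theorem exists_update (h : IsFrame g d a c) (hg : DifferentiableOn ℂ g {z | z ≠ 0}) {z₀ : ℂ}
    (hz₀ : (a z₀).det = 0) :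
    ∃ (j : n) (a' c' : ℂ → Matrix n n ℂ), IsFrame g (Function.update d j (d j - 1)) a' c' := by
  obtain ⟨l, hl, hal⟩ := exists_mulVec_eq_zero_iff.2 hz₀
  obtain ⟨i₀, hi₀⟩ := Function.ne_iff.1 hl
  obtain ⟨j, hj, hmax⟩ := (Finset.univ.filter fun i => l i ≠ 0).exists_max_image d
    ⟨i₀, by simpa using hi₀⟩
  simp only [Finset.mem_filter, Finset.mem_univ, true_and] at hj hmax
  have ha := h.differentiable_left
  have hc := h.differentiable_right
  set v : ℂ → n → ℂ := fun z => a z *ᵥ l with hv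
  have hvd : Differentiable ℂ v := differentiableOn_univ.1
    (ha.differentiableOn.matrix_mulVec (differentiableOn_const l))
  set u : ℂ → n → ℂ := dslope v z₀ with hu
  have hud : Differentiable ℂ u := differentiableOn_univ.1
    ((Complex.differentiableOn_dslope univ_mem).2 hvd.differentiableOn)
  have huv : ∀ z, (z - z₀) • u z = v z := fun z => by
    rw [hu, sub_smul_dslope, show v z₀ = 0 from hal, sub_zero]
  set q : ℂ → n → ℂ := fun w => c w *ᵥ fun i => l i * w ^ (d j - d i).toNat with hq
  have hqd : Differentiable ℂ q := differentiableOn_univ.1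
    (hc.differentiableOn.matrix_mulVec (differentiableOn_pi.2 fun i =>
      ((differentiable_id.pow _).const_mul _).differentiableOn))
  have hopen : IsOpen {z : ℂ | z ≠ 0} := isOpen_ne
  have hrel : ∀ w : ℂ, w ≠ 0 → w ^ d j • (g w⁻¹ *ᵥ v w⁻¹) = q w := by
    intro w hw
    rw [hv, hq]
    simp only
    rw [mulVec_mulVec, h.mul_eq _ (inv_ne_zero hw), inv_inv, ← mulVec_mulVec, ← mulVec_smul]
    congr 1
    funext i
    simp only [Pi.smul_apply, mulVec_diagonal, smul_eq_mul]
    by_cases hi : l i = 0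
    · simp [hi]
    · have h1 : w ^ (d j - d i).toNat = w ^ d j * (w⁻¹) ^ d i := by
        rw [← zpow_natCast, Int.toNat_of_nonneg (sub_nonneg.2 (hmax i hi)), zpow_sub₀ hw, _root_.inv_zpow,
          div_eq_mul_inv]
      rw [h1]; ring
  obtain ⟨p, hpd, hp, -⟩ := exists_differentiable_glue (U := {w : ℂ | w ≠ 0})
    (V := {w | 1 - z₀ * w ≠ 0}) hopen
    (isOpen_ne_fun (by fun_prop) continuous_const)
    (fun w => by
      rw [or_iff_not_imp_left]; intro h0; rw [mem_ofPred_eq, not_not] at h0; simp [h0])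
    (f := fun w => w ^ (d j - 1) • (g w⁻¹ *ᵥ u w⁻¹)) (g := fun w => (1 - z₀ * w)⁻¹ • q w)
    (DifferentiableOn.smul (fun w hw => (differentiableAt_zpow.2 (Or.inl hw)
      ).differentiableWithinAt) ((hg.comp differentiableOn_inv fun w hw => inv_ne_zero hw
      ).matrix_mulVec (hud.comp_differentiableOn differentiableOn_inv)))
    (DifferentiableOn.smul (DifferentiableOn.inv (by fun_prop) fun w hw => hw)
      hqd.differentiableOn)
    (fun w hw hw' => by
      rw [eq_inv_smul_iff₀ hw', ← hrel w hw, ← huv, mulVec_smul, smul_smul, smul_smul,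
        zpow_sub_one₀ hw]
      congr 1
      have hw0 : w ≠ 0 := hw
      field_simp)
  refine ⟨j, fun z => (a z).updateCol j (u z), fun w => (c w).updateCol j (p w),
    ha.matrix_updateCol hud j, hc.matrix_updateCol hpd j, fun z hz => ?_, fun h0 => ?_⟩
  · ext i k
    rw [mul_diagonal]
    by_cases hk : k = j
    · subst hk
      rw [updateCol_self, hp (inv_ne_zero hz)]
      simp only [Function.update_self, inv_inv, Pi.smul_apply, smul_eq_mul]
      rw [mul_right_comm, ← mul_zpow, inv_mul_cancel₀ hz, _root_.one_zpow, one_mul]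
      simp [mul_apply, mulVec, dotProduct]
    · have h1 := congrFun (congrFun (h.mul_eq z hz) i) k
      rw [mul_diagonal] at h1
      rw [updateCol_ne hk, Function.update_of_ne hk, ← h1]
      simp [mul_apply, hk]
  · have h1 : ((a 1).updateCol j (v 1)).det = (a 1).det * l j := by
      rw [← cramer_apply, cramer_eq_adjugate_mulVec, hv, mulVec_mulVec, adjugate_mul]
      simp [smul_mulVec]
    rw [← huv, det_updateCol_smul, h0, mul_zero] at h1
    exact mul_ne_zero h.det_ne_zero hj h1.symm

end IsFrame

theorem exists_isFrame {g : ℂ → Matrix n n ℂ} (hg : DifferentiableOn ℂ g {z | z ≠ 0})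
    (hu : ∀ z, z ≠ 0 → IsUnit (g z)) :
    ∃ (d : n → ℤ) (a c : ℂ → Matrix n n ℂ), IsFrame g d a c := by
  have : CompleteSpace (Matrix n n ℂ) := FiniteDimensional.complete ℂ _
  have h_one : ‖(1 : Matrix n n ℂ)‖ ≤ 1 := by
    cases isEmpty_or_nonempty n
    · simp [Subsingleton.elim (1 : Matrix n n ℂ) 0]
    · exact norm_one.le
  obtain ⟨N, a, c, ha, hc, h, h1⟩ := exists_global_sections h_one hg hu
  refine ⟨fun _ => N, a, c, ha, hc, fun z hz => ?_, ((isUnit_iff_isUnit_det _).1 h1).ne_zero⟩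
  rw [h z hz, ← smul_one_eq_diagonal, mul_smul_comm, mul_one, zpow_natCast]

/-- The degrees of the frames of a given bundle are bounded below. -/
theorem exists_le_sum_of_isFrame {g : ℂ → Matrix n n ℂ} (hg : DifferentiableOn ℂ g {z | z ≠ 0})
    (hu : ∀ z, z ≠ 0 → IsUnit (g z)) :
    ∃ K : ℤ, ∀ d a c, IsFrame g d a c → K ≤ ∑ i, d i := by
  have hdet : ∀ z, z ≠ 0 → (g z).det ≠ 0 := fun z hz =>
    ((isUnit_iff_isUnit_det _).1 (hu z hz)).ne_zero
  obtain ⟨N, f, e, hf, he, hfe, hf1⟩ := exists_global_sections (A := ℂ) norm_one.le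
    (hg.matrix_det.inv hdet) fun z hz => (inv_ne_zero (hdet z hz)).isUnit
  refine ⟨-N, fun d a c h => ?_⟩
  by_contra! hlt
  have key := eq_zero_of_eq_zpow_mul_inv (F := fun z => f z * (a z).det)
    (G := fun w => e w * (c w).det) (k := N + ∑ i, d i)
    (hf.mul (differentiableOn_univ.1 h.differentiable_left.differentiableOn.matrix_det))
    (he.mul (differentiableOn_univ.1
      h.differentiable_right.differentiableOn.matrix_det)).continuous.continuousAt
    (by lia) (fun z hz => by
      have h1 := congrArg det (h.mul_eq z hz)
      rw [det_mul, det_mul, det_diagonal, prod_zpow_eq_zpow_sum d hz] at h1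
      have h2 : (g z).det⁻¹ * f z = z ^ N * e z⁻¹ := hfe z hz
      rw [zpow_add₀ hz, zpow_natCast]
      have h3 := hdet z hz
      calc f z * (a z).det = ((g z).det⁻¹ * f z) * ((g z).det * (a z).det) := by field_simp
        _ = _ := by rw [h1, h2]; ring) 1
  exact mul_ne_zero hf1.ne_zero h.det_ne_zero key

/-- A frame of minimal degree is an isomorphism. -/
theorem exists_isFrame_isUnit {g : ℂ → Matrix n n ℂ} (hg : DifferentiableOn ℂ g {z | z ≠ 0})
    (hu : ∀ z, z ≠ 0 → IsUnit (g z)) :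
    ∃ (d : n → ℤ) (a c : ℂ → Matrix n n ℂ), IsFrame g d a c ∧ (∀ z, IsUnit (a z)) ∧
      ∀ w, IsUnit (c w) := by
  obtain ⟨K, hK⟩ := exists_le_sum_of_isFrame hg hu
  obtain ⟨d₀, a₀, c₀, h₀⟩ := exists_isFrame hg hu
  obtain ⟨s, ⟨d, a, c, h, rfl⟩, hmin⟩ := Int.exists_least_of_bdd
    (P := fun s => ∃ d a c, IsFrame g d a c ∧ ∑ i, d i = s)
    ⟨K, fun s ⟨d, a, c, h, hs⟩ => hs ▸ hK d a c h⟩ ⟨_, d₀, a₀, c₀, h₀, rfl⟩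
  have hsum : ∀ j, ∑ i, Function.update d j (d j - 1) i < ∑ i, d i := fun j =>
    Finset.sum_lt_sum (fun i _ => by by_cases hi : i = j <;> simp [hi])
      ⟨j, Finset.mem_univ j, by simp⟩
  refine ⟨d, a, c, h, fun z => ?_, fun w => ?_⟩
  · rw [isUnit_iff_isUnit_det, isUnit_iff_ne_zero]
    intro hz
    obtain ⟨j, a', c', h'⟩ := h.exists_update hg hz
    exact (hsum j).not_ge (hmin _ ⟨_, a', c', h', rfl⟩)
  · rw [isUnit_iff_isUnit_det, isUnit_iff_ne_zero]
    intro hw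
    have hu' : ∀ w : ℂ, w ≠ 0 → IsUnit (g w⁻¹)⁻¹ := fun w hw =>
      isUnit_nonsing_inv_iff.2 (hu _ (inv_ne_zero hw))
    obtain ⟨j, a', c', h'⟩ := (h.swap hu).exists_update (DifferentiableOn.matrix_inv isOpen_ne
      (hg.comp differentiableOn_inv fun w hw => inv_ne_zero hw)
      fun w hw => hu _ (inv_ne_zero hw)) hw
    have h'' := h'.swap hu'
    simp only [inv_inv] at h''
    refine (hsum j).not_ge (hmin _ ⟨_, c', a', ?_, rfl⟩)
    refine ⟨h''.differentiable_left, h''.differentiable_right, fun z hz => ?_, h''.det_ne_zero⟩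
    rw [← h''.mul_eq z hz, nonsing_inv_nonsing_inv _ ((isUnit_iff_isUnit_det _).1 (hu z hz))]

/-- A holomorphic isomorphism between two split bundles forces an inequality of the weights. -/
theorem le_of_mul_diagonal_eq {r : ℕ} {d d' : Fin r → ℤ} (hd : Antitone d) (hd' : Antitone d')
    {a c : ℂ → Matrix (Fin r) (Fin r) ℂ} (ha : Differentiable ℂ a) (hc : Differentiable ℂ c)
    (hdet : ∃ z, (a z).det ≠ 0)
    (h : ∀ z, z ≠ 0 →
      (c z⁻¹ * diagonal fun i => z ^ d' i) = (diagonal fun i => z ^ d i) * a z) :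
    d ≤ d' := by
  obtain ⟨z, hz⟩ := hdet
  by_contra hle
  obtain ⟨k, hk⟩ := not_forall.1 hle
  rw [not_le] at hk
  rw [differentiable_matrix_iff] at ha hc
  have hzero : ∀ i j, i ≤ k → k ≤ j → a z i j = 0 := by
    intro i j hi hj
    have hlt : d' j - d i < 0 := by
      have h1 := hd hi
      have h2 := hd' hj
      lia
    refine eq_zero_of_eq_zpow_mul_inv (ha i j) (hc i j).continuous.continuousAt hlt
      (fun x hx => ?_) z
    have h1 := congrFun (congrFun (h x hx) i) j
    rw [mul_diagonal, diagonal_mul] at h1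
    rw [zpow_sub₀ hx, div_mul_eq_mul_div, mul_comm (x ^ d' j), h1,
      mul_div_cancel_left₀ _ (zpow_ne_zero _ hx)]
  refine hz ?_
  rw [det_apply]
  refine Finset.sum_eq_zero fun σ _ => ?_
  suffices hex : ∃ j, k ≤ j ∧ σ j ≤ k by
    obtain ⟨j, hj, hσ⟩ := hex
    have h0 : ∏ i, a z (σ i) i = 0 := Finset.prod_eq_zero (Finset.mem_univ j) (hzero _ _ hσ hj)
    rw [h0, smul_zero]
  by_contra! hno
  have hcard := Finset.card_le_card_of_injOn (s := Finset.Ici k) (t := Finset.Ioi k) σ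
    (fun j hj => by simpa using hno j (by simpa using hj)) σ.injective.injOn
  rw [Fin.card_Ici, Fin.card_Ioi] at hcard
  have := k.isLt
  lia

theorem exists_clutchingEquiv_diagonal {r : ℕ} {g : ℂ → Matrix (Fin r) (Fin r) ℂ}
    (hg : DifferentiableOn ℂ g {z | z ≠ 0}) (hu : ∀ z, z ≠ 0 → IsUnit (g z)) :
    ∃ d : Fin r → ℤ, Antitone d ∧ ClutchingEquiv r g fun z => diagonal fun i => z ^ d i := by
  obtain ⟨d, a, c, h, ha, hc⟩ := exists_isFrame_isUnit hg hu
  have hci : Differentiable ℂ fun w => (c w)⁻¹ := differentiableOn_univ.1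
    (h.differentiable_right.differentiableOn.matrix_inv isOpen_univ fun w _ => hc w)
  set σ : Equiv.Perm (Fin r) := Tuple.sort fun i => -d i
  refine ⟨d ∘ σ, fun i j hij => neg_le_neg_iff.1 (Tuple.monotone_sort (fun i => -d i) hij),
    fun z => (a z).submatrix id σ, fun w => (c w)⁻¹.submatrix σ id,
    fun i j => differentiable_matrix_iff.1 h.differentiable_left i (σ j),
    fun z => (isUnit_submatrix_equiv (Equiv.refl _) σ).2 (ha z),
    fun i j => differentiable_matrix_iff.1 hci (σ i) j,
    fun w => (isUnit_submatrix_equiv σ (Equiv.refl _)).2 (isUnit_nonsing_inv_iff.2 (hc w)),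
    fun z hz => ?_⟩
  have h1 : (c z⁻¹)⁻¹ * g z * a z = diagonal fun i => z ^ d i := by
    rw [Matrix.mul_assoc, h.mul_eq z hz,
      nonsing_inv_mul_cancel_left _ _ ((isUnit_iff_isUnit_det _).1 (hc z⁻¹))]
  have h2 : (c z⁻¹)⁻¹.submatrix σ id * g z * (a z).submatrix id σ =
      ((c z⁻¹)⁻¹ * g z * a z).submatrix σ σ := rfl
  rw [h2, h1, submatrix_diagonal_equiv]
  rfl

theorem le_of_clutchingEquiv_diagonal {r : ℕ} {g : ℂ → Matrix (Fin r) (Fin r) ℂ}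
    {d d' : Fin r → ℤ} (hd : Antitone d) (hd' : Antitone d')
    (h : ClutchingEquiv r g fun z => diagonal fun i => z ^ d i)
    (h' : ClutchingEquiv r g fun z => diagonal fun i => z ^ d' i) : d ≤ d' := by
  obtain ⟨a, b, ha, hau, hb, hbu, hab⟩ := h
  obtain ⟨a', b', ha', hau', hb', hbu', hab'⟩ := h'
  rw [← differentiable_matrix_iff] at ha hb ha' hb'
  have hai : Differentiable ℂ fun z => (a z)⁻¹ := differentiableOn_univ.1
    (ha.differentiableOn.matrix_inv isOpen_univ fun z _ => hau z)
  have hbi : Differentiable ℂ fun z => (b' z)⁻¹ := differentiableOn_univ.1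
    (hb'.differentiableOn.matrix_inv isOpen_univ fun z _ => hbu' z)
  refine le_of_mul_diagonal_eq hd hd' (a := fun z => (a z)⁻¹ * a' z)
    (c := fun w => b w * (b' w)⁻¹) (hai.mul ha') (hb.mul hbi) ⟨0, ?_⟩ fun z hz => ?_
  · exact ((isUnit_iff_isUnit_det _).1 ((isUnit_nonsing_inv_iff.2 (hau 0)).mul (hau' 0))).ne_zero
  · have h1 := hab z hz
    have h2 := hab' z hz
    simp only at h1 h2
    rw [h1, h2]
    simp only [Matrix.mul_assoc]
    rw [nonsing_inv_mul_cancel_left _ _ ((isUnit_iff_isUnit_det _).1 (hbu' z⁻¹)),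
      mul_nonsing_inv_cancel_left _ _ ((isUnit_iff_isUnit_det _).1 (hau z))]

end Matrices

end BirkhoffGrothendieck

/-- **Birkhoff–Grothendieck**: every rank `r` holomorphic vector bundle over `ℂP¹`,
given by a holomorphic clutching function `g`, is holomorphically isomorphic to
`⊕_{i=1}^r O(d i)` for a unique antitone tuple of weights `d : Fin r → ℤ`. -/
theorem birkhoff_grothendieck (r : ℕ) (g : ℂ → Matrix (Fin r) (Fin r) ℂ)
    (hg : ∀ i j, DifferentiableOn ℂ (fun z => g z i j) {z : ℂ | z ≠ 0})
    (hginv : ∀ z : ℂ, z ≠ 0 → IsUnit (g z)) :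
    ∃! d : Fin r → ℤ, Antitone d ∧
      ClutchingEquiv r g (fun z => Matrix.diagonal fun i => z ^ (d i)) := by
  have hg' : DifferentiableOn ℂ g {z | z ≠ 0} :=
    differentiableOn_matrix_iff.2 hg
  obtain ⟨d, hd, h⟩ := exists_clutchingEquiv_diagonal hg' hginv
  exact ⟨d, ⟨hd, h⟩, fun d' ⟨hd', h'⟩ => le_antisymm
    (le_of_clutchingEquiv_diagonal hd' hd h' h)
    (le_of_clutchingEquiv_diagonal hd hd' h h')⟩
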